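/- arXiv:1710.10524 — 4 statements merged into one kernel-verified Lean document; each statement's English description precedes it below -/
import Mathlib

section
/- Let D = (E, 𝓕) be a delta-matroid. Let 𝓕_max be the collection of feasible sets of maximum cardinality and 𝓕_min the collection of feasible sets of minimum cardinality. Then both 𝓕_max and 𝓕_min satisfy the matroid basis exchange axiom: for all X, Y in the collection and every a ∈ X ∖ Y there exists b ∈ Y ∖ X such that (X ∖ {a}) ∪ {b} is in the collection. In particular D_max = (E, 𝓕_max) and D_min = (E, 𝓕_min) are matroids. -/
open Finset

/-- The symmetric exchange axiom for a collection of feasible sets. -/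
def SymExch {α : Type*} [DecidableEq α] (𝓕 : Finset (Finset α)) : Prop :=
  ∀ X ∈ 𝓕, ∀ Y ∈ 𝓕, ∀ a ∈ symmDiff X Y, ∃ b ∈ symmDiff X Y, symmDiff X {a, b} ∈ 𝓕

/-- The matroid basis exchange axiom for a collection of sets. -/
def BasisExch {α : Type*} [DecidableEq α] (𝓑 : Finset (Finset α)) : Prop :=
  ∀ X ∈ 𝓑, ∀ Y ∈ 𝓑, ∀ a ∈ X \ Y, ∃ b ∈ Y \ X, insert b (X.erase a) ∈ 𝓑

theorem dual_to_exch {α : Type*} [DecidableEq α] (𝓑 : Finset (Finset α))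
    (hc : ∀ X ∈ 𝓑, ∀ Y ∈ 𝓑, X.card = Y.card)
    (hd : ∀ X ∈ 𝓑, ∀ Y ∈ 𝓑, ∀ a ∈ X \ Y, ∃ b ∈ Y \ X, insert a (Y.erase b) ∈ 𝓑) :
    ∀ n : ℕ, ∀ X ∈ 𝓑, ∀ Y ∈ 𝓑, (X \ Y).card = n → ∀ a ∈ X \ Y,
      ∃ b ∈ Y \ X, insert b (X.erase a) ∈ 𝓑 := by
  intro n
  induction n with
  | zero =>
    intro X _ Y _ h a ha
    rw [Finset.card_eq_zero] at h
    simp [h] at ha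
  | succ n ih =>
    intro X hX Y hY h a ha
    by_cases hcx : ∃ c ∈ X \ Y, c ≠ a
    · obtain ⟨c, hcm, hca⟩ := hcx
      obtain ⟨d, hdm, hd'⟩ := hd X hX Y hY c hcm
      have e : X \ insert c (Y.erase d) = (X \ Y).erase c := by
        ext x
        simp only [mem_sdiff, mem_insert, mem_erase] at *
        grind
      obtain ⟨b, hb, hb'⟩ := ih X hX _ hd' (by rw [e, card_erase_of_mem hcm]; omega) a
        (by rw [e]; exact mem_erase.2 ⟨hca.symm, ha⟩)
      refine ⟨b, ?_, hb'⟩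
      simp only [mem_sdiff, mem_insert, mem_erase] at *
      grind
    · push Not at hcx
      obtain ⟨b, hb, -⟩ := hd X hX Y hY a ha
      refine ⟨b, hb, ?_⟩
      have e : insert b (X.erase a) = Y := by
        have h1 : X.erase a ⊆ Y := by
          intro x hx
          have := hcx x
          simp only [mem_sdiff, mem_erase] at *
          grind
        apply Finset.eq_of_subset_of_card_le
        · exact Finset.insert_subset (mem_sdiff.1 hb).1 h1
        · have := hc X hX Y hY
          rw [card_insert_of_notMem (fun h => (mem_sdiff.1 hb).2 (mem_of_mem_erase h)),
            card_erase_add_one (mem_sdiff.1 ha).1]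
          omega
      rw [e]; exact hY

/-- The maximum-cardinality and minimum-cardinality feasible sets of a
delta-matroid each satisfy the matroid basis exchange axiom, hence
`D_max` and `D_min` are matroids. -/
theorem maxMin_feasible_basisExchange {α : Type*} [DecidableEq α]
    (E : Finset α) (𝓕 : Finset (Finset α))
    (hne : 𝓕.Nonempty) (hsub : ∀ F ∈ 𝓕, F ⊆ E) (hex : SymExch 𝓕) :
    BasisExch (𝓕.filter (fun F => ∀ G ∈ 𝓕, G.card ≤ F.card)) ∧
      BasisExch (𝓕.filter (fun F => ∀ G ∈ 𝓕, F.card ≤ G.card)) := by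
  constructor
  · intro X hX Y hY a ha
    refine dual_to_exch _ ?_ ?_ _ X hX Y hY rfl a ha
    · intro X hX Y hY
      simp only [mem_filter] at hX hY
      exact le_antisymm (hY.2 X hX.1) (hX.2 Y hY.1)
    · intro X hX Y hY a ha
      simp only [mem_filter] at hX hY
      rw [mem_sdiff] at ha
      obtain ⟨b, hb, h⟩ := hex Y hY.1 X hX.1 a (by simp [mem_symmDiff, ha])
      have hle := hY.2 _ h
      rw [mem_symmDiff] at hb
      rcases hb with hb | hb
      · have e : symmDiff Y {a, b} = insert a (Y.erase b) := by
          ext x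
          simp only [mem_symmDiff, mem_insert, mem_singleton, mem_erase]
          grind
        have hcard : (insert a (Y.erase b)).card = Y.card := by
          rw [card_insert_of_notMem (fun h => ha.2 (mem_of_mem_erase h)),
            card_erase_add_one hb.1]
        refine ⟨b, mem_sdiff.2 hb, ?_⟩
        rw [mem_filter, hcard, ← e]
        exact ⟨h, hY.2⟩
      · exfalso
        have : Y ⊂ symmDiff Y {a, b} := by
          rw [Finset.ssubset_iff_of_subset]
          · exact ⟨a, by simp [mem_symmDiff, ha.2], ha.2⟩
          · intro x hx
            simp only [mem_symmDiff, mem_insert, mem_singleton]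
            grind
        have := card_lt_card this
        omega
  · intro X hX Y hY a ha
    simp only [mem_filter] at hX hY
    rw [mem_sdiff] at ha
    obtain ⟨b, hb, h⟩ := hex X hX.1 Y hY.1 a (by simp [mem_symmDiff, ha])
    have hle := hX.2 _ h
    rw [mem_symmDiff] at hb
    rcases hb with hb | hb
    · exfalso
      have : symmDiff X {a, b} ⊂ X := by
        rw [Finset.ssubset_iff_of_subset]
        · exact ⟨a, ha.1, by simp [mem_symmDiff, ha.1]⟩
        · intro x hx
          simp only [mem_symmDiff, mem_insert, mem_singleton] at hx
          grind
      have := card_lt_card this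
      omega
    · have e : symmDiff X {a, b} = insert b (X.erase a) := by
        ext x
        simp only [mem_symmDiff, mem_insert, mem_singleton, mem_erase]
        grind
      have hcard : (insert b (X.erase a)).card = X.card := by
        rw [card_insert_of_notMem (fun h => hb.2 (mem_of_mem_erase h)),
          card_erase_add_one ha.1]
      refine ⟨b, mem_sdiff.2 hb, ?_⟩
      rw [mem_filter, hcard, ← e]
      exact ⟨h, hX.2⟩
end

section
/- Let M = (E, 𝓑) be a matroid given by its bases, let < be a total order on E, let B ∈ 𝓑, and let b ∈ E. Then: (i) b is externally active in the classical sense (b ∉ B and b is the least element of the fundamental circuit C(B;b)) if and only if b ∉ B and b is active with respect to B in the delta-matroid sense (no c < b is B-interlaced with b); (ii) dually, b is internally active in the classical sense (b ∈ B and b is the least element of the fundamental circuit of b with respect to the basis E ∖ B of the dual matroid M*) if and only if b ∈ B and b is active with respect to B in the delta-matroid sense. -/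
open Finset

/-- A point `x` is `B`-nonorientable if `B Δ {x}` is feasible. -/
def FNonorientable {α : Type*} [DecidableEq α] (𝓕 : Finset (Finset α))
    (F : Finset α) (a : α) : Prop :=
  symmDiff F {a} ∈ 𝓕

/-- Distinct points are `B`-interlaced if either at most one of them is
`B`-nonorientable and `B Δ {x,y}` is feasible, or both are
`B`-nonorientable and `B Δ {x,y}` is not feasible. -/
def FInterlaced {α : Type*} [DecidableEq α] (𝓕 : Finset (Finset α))
    (F : Finset α) (a b : α) : Prop :=
  a ≠ b ∧
    ((¬(FNonorientable 𝓕 F a ∧ FNonorientable 𝓕 F b) ∧ symmDiff F {a, b} ∈ 𝓕) ∨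
      (FNonorientable 𝓕 F a ∧ FNonorientable 𝓕 F b ∧ symmDiff F {a, b} ∉ 𝓕))

/-- Given a total order, a point is active with respect to `F` if no
lower-ordered point is `F`-interlaced with it. -/
def ActiveWrt {α : Type*} [LinearOrder α] (𝓕 : Finset (Finset α))
    (F : Finset α) (a : α) : Prop :=
  ∀ c, c < a → ¬ FInterlaced 𝓕 F c a

/-- A set is independent if it is contained in some basis. -/
def IndepIn {α : Type*} (𝓑 : Finset (Finset α)) (I : Finset α) : Prop :=
  ∃ B ∈ 𝓑, I ⊆ B

/-- A circuit is a minimal dependent set. -/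
def CircuitIn {α : Type*} (𝓑 : Finset (Finset α)) (C : Finset α) : Prop :=
  ¬ IndepIn 𝓑 C ∧ ∀ C' ⊂ C, IndepIn 𝓑 C'

theorem aux_exch {α : Type*} [DecidableEq α] (𝓑 : Finset (Finset α))
    (hcard : ∀ B ∈ 𝓑, ∀ B' ∈ 𝓑, B.card = B'.card)
    (hex : ∀ X ∈ 𝓑, ∀ Y ∈ 𝓑, ∀ x ∈ X \ Y, ∃ y ∈ Y \ X, insert y (X.erase x) ∈ 𝓑)
    (B : Finset α) (hB : B ∈ 𝓑) (b : α) (hb : b ∉ B) (S : Finset α) (hS : S ⊆ B) :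
    ∀ n : ℕ, ∀ B' ∈ 𝓑, insert b S ⊆ B' → (B' \ B).card = n →
      ∃ c ∈ B, c ∉ S ∧ insert b (B.erase c) ∈ 𝓑 := by
  intro n
  induction n using Nat.strong_induction_on with
  | _ n ih =>
    intro B' hB' hD hn
    have hbB' : b ∈ B' := hD (by simp)
    by_cases h : ∃ x ∈ B' \ B, x ≠ b
    · obtain ⟨x, hx, hxb⟩ := h
      obtain ⟨y, hy, hy2⟩ := hex B' hB' B hB x hx
      refine ih _ ?_ _ hy2 ?_ rfl
      · rw [← hn]
        apply Finset.card_lt_card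
        rw [Finset.ssubset_iff_of_subset]
        · exact ⟨x, hx, by grind⟩
        · intro z; grind
      · intro z hz
        have := hD hz
        have : z ≠ x := by grind
        grind
    · push Not at h
      have h1 : B' \ B = {b} := by
        ext z; simp only [Finset.mem_singleton]
        exact ⟨h z, by rintro rfl; simp [hbB', hb]⟩
      have h2 : (B \ B').card = 1 := by
        have e1 := Finset.card_sdiff_add_card_inter B B'
        have e2 := Finset.card_sdiff_add_card_inter B' B
        rw [Finset.inter_comm, h1] at e2
        have := hcard B hB B' hB'
        simp at e2
        omega
      obtain ⟨c, hc⟩ := Finset.card_eq_one.1 h2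
      have hc' : ∀ z, z ∈ B \ B' ↔ z = c := by simp [hc]
      have hb' : ∀ z, z ∈ B' \ B ↔ z = b := by simp [h1]
      have hcc := (hc' c).2 rfl
      refine ⟨c, by grind, fun hcS => ?_, ?_⟩
      · have := hD (Finset.mem_insert_of_mem hcS)
        grind
      · convert hB' using 1
        ext z
        have := hc' z
        have := hb' z
        grind

theorem aux_circ {α : Type*} [LinearOrder α] (𝓑 : Finset (Finset α)) :
    ∀ n : ℕ, ∀ D : Finset α, D.card = n → ¬ IndepIn 𝓑 D →
      ∃ C, CircuitIn 𝓑 C ∧ C ⊆ D := by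
  intro n
  induction n using Nat.strong_induction_on with
  | _ n ih =>
    intro D hn hD
    by_cases h : ∀ C' ⊂ D, IndepIn 𝓑 C'
    · exact ⟨D, ⟨hD, h⟩, subset_rfl⟩
    · push Not at h
      obtain ⟨C', hC', hd⟩ := h
      obtain ⟨C, h1, h2⟩ := ih _ (hn ▸ Finset.card_lt_card hC') C' rfl hd
      exact ⟨C, h1, h2.trans hC'.1⟩

theorem aux_main {α : Type*} [LinearOrder α] (𝓑 : Finset (Finset α))
    (hcard : ∀ B ∈ 𝓑, ∀ B' ∈ 𝓑, B.card = B'.card)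
    (hex : ∀ X ∈ 𝓑, ∀ Y ∈ 𝓑, ∀ x ∈ X \ Y, ∃ y ∈ Y \ X, insert y (X.erase x) ∈ 𝓑)
    (B : Finset α) (hB : B ∈ 𝓑) (b : α) (hb : b ∉ B) :
    (∃ C, CircuitIn 𝓑 C ∧ C ⊆ insert b B ∧ ∀ c ∈ C, b ≤ c) ↔
      ∀ c ∈ B, c < b → insert b (B.erase c) ∉ 𝓑 := by
  constructor
  · rintro ⟨C, hC, hCB, hmin⟩ c hc hcb hmem
    refine hC.1 ⟨_, hmem, fun z hz => ?_⟩
    have h1 := hCB hz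
    have h2 := hmin z hz
    have : z ≠ c := by rintro rfl; exact absurd hcb (not_lt.2 h2)
    grind
  · intro h
    have hD : ¬ IndepIn 𝓑 (insert b (B.filter (fun x => b ≤ x))) := by
      rintro ⟨B', hB', hs⟩
      obtain ⟨c, hc, hcS, hm⟩ :=
        aux_exch 𝓑 hcard hex B hB b hb _ (Finset.filter_subset _ _) _ B' hB' hs rfl
      refine h c hc ?_ hm
      by_contra hh
      exact hcS (Finset.mem_filter.2 ⟨hc, not_lt.1 hh⟩)
    obtain ⟨C, h1, h2⟩ := aux_circ 𝓑 _ _ rfl hD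
    refine ⟨C, h1, fun z hz => ?_, fun z hz => ?_⟩
    · have := h2 hz
      grind
    · have := h2 hz
      simp only [Finset.mem_insert, Finset.mem_filter] at this
      rcases this with h | h
      · exact h.ge
      · exact h.2

theorem aux_inter {α : Type*} [LinearOrder α] (𝓑 : Finset (Finset α))
    (hcard : ∀ B ∈ 𝓑, ∀ B' ∈ 𝓑, B.card = B'.card)
    (B : Finset α) (hB : B ∈ 𝓑) (b c : α) (hcb : c ≠ b) :
    FInterlaced 𝓑 B c b ↔ (b ∉ B ∧ c ∈ B ∧ insert b (B.erase c) ∈ 𝓑) ∨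
      (b ∈ B ∧ c ∉ B ∧ insert c (B.erase b) ∈ 𝓑) := by
  have hno : ∀ a, ¬ FNonorientable 𝓑 B a := by
    intro a ha
    have h := hcard _ ha B hB
    by_cases haB : a ∈ B
    · have e : symmDiff B {a} = B.erase a := by
        ext z; simp only [Finset.mem_symmDiff, Finset.mem_singleton]; grind
      rw [e] at h
      have := Finset.card_erase_lt_of_mem haB
      omega
    · have e : symmDiff B {a} = insert a B := by
        ext z; simp only [Finset.mem_symmDiff, Finset.mem_singleton]; grind
      rw [e, Finset.card_insert_of_notMem haB] at h
      omega
  have h0 : FInterlaced 𝓑 B c b ↔ symmDiff B {c, b} ∈ 𝓑 := by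
    simp [FInterlaced, hno, hcb]
  rw [h0]
  by_cases hb : b ∈ B <;> by_cases hc : c ∈ B <;> simp only [hb, hc, not_true, not_false_eq_true, true_and, false_and, or_false, false_or, iff_false]
  · intro h
    have h := hcard _ h B hB
    have : symmDiff B {c, b} ⊂ B := by
      rw [Finset.ssubset_iff_of_subset]
      · exact ⟨b, hb, by simp [Finset.mem_symmDiff, hb]⟩
      · intro z; simp only [Finset.mem_symmDiff, Finset.mem_singleton, Finset.mem_insert]; grind
    have := Finset.card_lt_card this
    omega
  · have e : symmDiff B {c, b} = insert c (B.erase b) := by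
      ext z; simp only [Finset.mem_symmDiff, Finset.mem_singleton, Finset.mem_insert]; grind
    rw [e]
  · have e : symmDiff B {c, b} = insert b (B.erase c) := by
      ext z; simp only [Finset.mem_symmDiff, Finset.mem_singleton, Finset.mem_insert]; grind
    rw [e]
  · intro h
    have h := hcard _ h B hB
    have : B ⊂ symmDiff B {c, b} := by
      rw [Finset.ssubset_iff_of_subset]
      · exact ⟨b, by simp [Finset.mem_symmDiff, hb], hb⟩
      · intro z; simp only [Finset.mem_symmDiff, Finset.mem_singleton, Finset.mem_insert]; grind
    have := Finset.card_lt_card this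
    omega

/-- For a matroid `M = (E, 𝓑)`, a basis `B` and a point `b ∈ E`:
`b` is externally (resp. internally) active in the classical sense if and
only if `b` is external (resp. internal) and active in the delta-matroid
sense. -/
theorem classical_activity_iff_deltaMatroid_activity {α : Type*} [LinearOrder α]
    (E : Finset α) (𝓑 : Finset (Finset α))
    (hne : 𝓑.Nonempty) (hsub : ∀ B ∈ 𝓑, B ⊆ E)
    (hcard : ∀ B ∈ 𝓑, ∀ B' ∈ 𝓑, B.card = B'.card)
    (hex : ∀ X ∈ 𝓑, ∀ Y ∈ 𝓑, ∀ x ∈ X \ Y, ∃ y ∈ Y \ X, insert y (X.erase x) ∈ 𝓑)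
    (B : Finset α) (hB : B ∈ 𝓑) (b : α) (hb : b ∈ E) :
    ((b ∉ B ∧ ∃ C, CircuitIn 𝓑 C ∧ C ⊆ insert b B ∧ ∀ c ∈ C, b ≤ c) ↔
        (b ∉ B ∧ ActiveWrt 𝓑 B b)) ∧
      ((b ∈ B ∧ ∃ C, CircuitIn (𝓑.image (fun B' => E \ B')) C ∧
          C ⊆ insert b (E \ B) ∧ ∀ c ∈ C, b ≤ c) ↔
        (b ∈ B ∧ ActiveWrt 𝓑 B b)) := by
  constructor
  · refine and_congr_right fun hbB => ?_
    rw [aux_main 𝓑 hcard hex B hB b hbB]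
    constructor
    · intro h c hc hi
      rw [aux_inter 𝓑 hcard B hB b c hc.ne] at hi
      rcases hi with hi | hi
      · exact h c hi.2.1 hc hi.2.2
      · exact hbB hi.1
    · intro h c hcB hc hm
      exact h c hc ((aux_inter 𝓑 hcard B hB b c hc.ne).2 (Or.inl ⟨hbB, hcB, hm⟩))
  · refine and_congr_right fun hbB => ?_
    rw [aux_main (𝓑.image (fun B' => E \ B')) ?_ ?_ (E \ B) (Finset.mem_image_of_mem _ hB) b
      (by simp [hbB])]
    · have key : ∀ c ∈ E, c ∉ B →
          (insert b ((E \ B).erase c) ∈ 𝓑.image (fun B' => E \ B') ↔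
            insert c (B.erase b) ∈ 𝓑) := by
        intro c hcE hcB
        have hBE := hsub B hB
        rw [Finset.mem_image]
        constructor
        · rintro ⟨B', hB', he⟩
          convert hB' using 1
          ext z
          have h1 := Finset.ext_iff.1 he z
          have h2 := @hsub B' hB' z
          have h3 := @hBE z
          grind
        · intro h
          refine ⟨_, h, ?_⟩
          ext z
          have h3 := @hBE z
          grind
      constructor
      · intro h c hc hi
        rw [aux_inter 𝓑 hcard B hB b c hc.ne] at hi
        rcases hi with hi | hi
        · exact hi.1 hbB
        · have hcE : c ∈ E := hsub _ hi.2.2 (by simp)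
          exact h c (by simp [hcE, hi.2.1]) hc ((key c hcE hi.2.1).2 hi.2.2)
      · intro h c hcB hc hm
        rw [Finset.mem_sdiff] at hcB
        exact h c hc ((aux_inter 𝓑 hcard B hB b c hc.ne).2
          (Or.inr ⟨hbB, hcB.2, (key c hcB.1 hcB.2).1 hm⟩))
    · simp only [Finset.forall_mem_image]
      intro X hX Y hY
      rw [Finset.card_sdiff_of_subset (hsub X hX), Finset.card_sdiff_of_subset (hsub Y hY),
        hcard X hX Y hY]
    · simp only [Finset.forall_mem_image]
      intro X hX Y hY x hx
      have hXE := hsub X hX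
      have hYE := hsub Y hY
      have hxX : x ∉ X := by grind
      have hxY : x ∈ Y := by grind
      obtain ⟨c, hc, hcS, hm⟩ := aux_exch 𝓑 hcard hex X hX x hxX (X ∩ Y)
        Finset.inter_subset_left _ Y hY (by intro z; grind) rfl
      refine ⟨c, ?_, Finset.mem_image.2 ⟨_, hm, ?_⟩⟩
      · have := hXE hc
        grind
      · ext z
        have := @hXE z
        have := hXE hc
        grind
end

section
/- Let D = (E, 𝓕) be a delta-matroid and let D' be obtained from D by a finite sequence of single-point deletions and contractions in which each point operated on is nonsingular in the current minor, with contracted set C and ground set E' = E ∖ (C ∪ X) where X is the deleted set. Suppose F ∈ 𝓕 is covered by D' (i.e., C ⊆ F ⊆ C ∪ E'), and suppose a, b ∈ E' are F-interlaced with at least one of a, b being F-orientable. Then both a and b are nonsingular in D'. -/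
open Finset

/-- `MinorSeq E 𝓕 E' 𝓕' C X` records that the delta-matroid `(E', 𝓕')` is
obtained from `(E, 𝓕)` by a finite sequence of single-point deletions and
contractions in which every point operated on is nonsingular in the
current minor; `C` is the contracted set and `X` the deleted set. -/
inductive MinorSeq {α : Type*} [DecidableEq α] (E : Finset α) (𝓕 : Finset (Finset α)) :
    Finset α → Finset (Finset α) → Finset α → Finset α → Prop
  | refl : MinorSeq E 𝓕 E 𝓕 ∅ ∅
  | del {E' : Finset α} {𝓕' : Finset (Finset α)} {C X : Finset α} {a : α} :
      MinorSeq E 𝓕 E' 𝓕' C X → a ∈ E' →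
      (∃ F ∈ 𝓕', a ∈ F) → (∃ F ∈ 𝓕', a ∉ F) →
      MinorSeq E 𝓕 (E'.erase a) (𝓕'.filter (fun F => a ∉ F)) C (insert a X)
  | con {E' : Finset α} {𝓕' : Finset (Finset α)} {C X : Finset α} {a : α} :
      MinorSeq E 𝓕 E' 𝓕' C X → a ∈ E' →
      (∃ F ∈ 𝓕', a ∈ F) → (∃ F ∈ 𝓕', a ∉ F) →
      MinorSeq E 𝓕 (E'.erase a) ((𝓕'.filter (fun F => a ∈ F)).image (fun F => F.erase a))
        (insert a C) X

theorem minorSeq_disj {α : Type*} [DecidableEq α] {E : Finset α} {𝓕 : Finset (Finset α)}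
    {E' : Finset α} {𝓕' : Finset (Finset α)} {C X : Finset α}
    (h : MinorSeq E 𝓕 E' 𝓕' C X) : ∀ x ∈ C, x ∉ E' := by
  induction h with
  | refl => simp
  | del _ _ _ _ ih => grind
  | con _ _ _ _ ih => grind

theorem minorSeq_mem {α : Type*} [DecidableEq α] {E : Finset α} {𝓕 : Finset (Finset α)}
    {E' : Finset α} {𝓕' : Finset (Finset α)} {C X : Finset α}
    (h : MinorSeq E 𝓕 E' 𝓕' C X) (H : Finset α) (hH : H ∈ 𝓕) :
    C ⊆ H → H ⊆ C ∪ E' → H \ C ∈ 𝓕' := by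
  induction h with
  | refl => intro _ _; simpa using hH
  | @del E' 𝓕' C X a h1 ha _ _ ih =>
    intro h2 h3
    have hd := minorSeq_disj h1 
    rw [Finset.mem_filter]
    refine ⟨ih h2 (by grind), by grind⟩
  | @con E' 𝓕' C X a h1 ha _ _ ih =>
    intro h2 h3
    have hd := minorSeq_disj h1
    rw [Finset.mem_image]
    refine ⟨H \ C, ?_, by grind⟩
    rw [Finset.mem_filter]
    refine ⟨ih (by grind) (by grind), by grind⟩

/-- If a minor `D'` covers the feasible set `F` and `a, b ∈ E'` are
`F`-interlaced with at least one of them `F`-orientable, then both `a` and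
`b` are nonsingular in `D'`. -/
theorem interlaced_nonsingular_in_covering_minor {α : Type*} [DecidableEq α]
    (E : Finset α) (𝓕 : Finset (Finset α))
    (hne : 𝓕.Nonempty) (hsub : ∀ F ∈ 𝓕, F ⊆ E) (hex : SymExch 𝓕)
    (E' : Finset α) (𝓕' : Finset (Finset α)) (C X : Finset α)
    (hminor : MinorSeq E 𝓕 E' 𝓕' C X)
    (F : Finset α) (hF : F ∈ 𝓕) (hcov : C ⊆ F ∧ F ⊆ C ∪ E')
    (a b : α) (haE' : a ∈ E') (hbE' : b ∈ E')
    (hint : FInterlaced 𝓕 F a b)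
    (hor : ¬ FNonorientable 𝓕 F a ∨ ¬ FNonorientable 𝓕 F b) :
    ((∃ H ∈ 𝓕', a ∈ H) ∧ (∃ H ∈ 𝓕', a ∉ H)) ∧
      ((∃ H ∈ 𝓕', b ∈ H) ∧ (∃ H ∈ 𝓕', b ∉ H)) := by
  obtain ⟨hab, h⟩ := hint
  have hG : symmDiff F {a, b} ∈ 𝓕 := by tauto
  have hd := minorSeq_disj hminor
  have haC : a ∉ C := fun h => hd a h haE'
  have hbC : b ∉ C := fun h => hd b h hbE'
  obtain ⟨hc1, hc2⟩ := hcov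
  have m1 := minorSeq_mem hminor F hF hc1 hc2
  have m2 := minorSeq_mem hminor _ hG
    (by intro x hx
        have := hc1 hx
        simp only [Finset.mem_symmDiff, Finset.mem_insert, Finset.mem_singleton]
        grind)
    (by intro x hx
        simp only [Finset.mem_symmDiff, Finset.mem_insert, Finset.mem_singleton] at hx
        grind)
  have key : ∀ x, x ∉ C → (x = a ∨ x = b) →
      ((∃ H ∈ 𝓕', x ∈ H) ∧ (∃ H ∈ 𝓕', x ∉ H)) := by
    intro x hxC hx
    by_cases hxF : x ∈ F
    · exact ⟨⟨_, m1, by simp [hxF, hxC]⟩, ⟨_, m2, by simp [Finset.mem_symmDiff, hxF, hx]⟩⟩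
    · exact ⟨⟨_, m2, by simp [Finset.mem_symmDiff, hxF, hx, hxC]⟩, ⟨_, m1, by simp [hxF]⟩⟩
  exact ⟨key a haC (Or.inl rfl), key b hbC (Or.inr rfl)⟩
end

section
/- Let D = (E, 𝓕) be a delta-matroid and let a ∈ E be nonsingular. Then, as an identity of real-valued functions (equivalently, of polynomials) in the variables w, x, y: Q_{(w,x,0)}(D;y) = w · Q_{(w,x,0)}(D ∖ a; y) + x · Q_{(w,x,0)}(D / a; y). -/
open Finset

/-- `dmin 𝓕 B` is the minimum cardinality of `F Δ B` over feasible `F`,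
i.e. the minimum cardinality of a feasible set of the twist `D*B`. -/
noncomputable def dmin {α : Type*} [DecidableEq α] (𝓕 : Finset (Finset α)) (B : Finset α) : ℕ :=
  sInf {n | ∃ F ∈ 𝓕, (symmDiff F B).card = n}

/-- The transition polynomial `Q_{(w,x,0)}(D;y)`, as a real-valued function. -/
noncomputable def transQ {α : Type*} [DecidableEq α] (E : Finset α)
    (𝓕 : Finset (Finset α)) (w x y : ℝ) : ℝ :=
  ∑ B ∈ E.powerset, w ^ (E.card - B.card) * x ^ B.card * y ^ dmin 𝓕 B

theorem dmin_le_aux {α : Type*} [DecidableEq α] (F G : Finset (Finset α)) (B C : Finset α)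
    (hF : F.Nonempty)
    (h : ∀ X ∈ F, ∃ Y ∈ G, (symmDiff Y C).card ≤ (symmDiff X B).card) :
    dmin G C ≤ dmin F B := by
  have hne : {n | ∃ X ∈ F, (symmDiff X B).card = n}.Nonempty := by
    obtain ⟨X, hX⟩ := hF
    exact ⟨_, X, hX, rfl⟩
  obtain ⟨X, hX, hXc⟩ := Nat.sInf_mem hne
  obtain ⟨Y, hY, hYc⟩ := h X hX
  unfold dmin
  rw [← hXc]
  exact le_trans (Nat.sInf_le ⟨Y, hY, rfl⟩) hYc

theorem exch_aux {α : Type*} [DecidableEq α] (𝓕 : Finset (Finset α)) (hex : SymExch 𝓕)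
    (a : α) (B X Z : Finset α) (hX : X ∈ 𝓕) (hZ : Z ∈ 𝓕) (hZa : a ∈ Z ↔ a ∈ B) :
    ∃ Y ∈ 𝓕, (a ∈ Y ↔ a ∈ B) ∧ (symmDiff Y B).card ≤ (symmDiff X B).card := by
  by_cases hXa : a ∈ X ↔ a ∈ B
  · exact ⟨X, hX, hXa, le_rfl⟩
  · obtain ⟨b, -, hY⟩ := hex X hX Z hZ a (by rw [Finset.mem_symmDiff]; tauto)
    refine ⟨_, hY, ?_, ?_⟩
    · simp only [Finset.mem_symmDiff, Finset.mem_insert, Finset.mem_singleton]; tauto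
    · have haX : a ∈ symmDiff X B := by rw [Finset.mem_symmDiff]; tauto
      have hs : symmDiff (symmDiff X {a, b}) B ⊆ insert b ((symmDiff X B).erase a) := by
        intro c
        by_cases hca : c = a
        · subst hca
          simp only [Finset.mem_symmDiff, Finset.mem_insert, Finset.mem_singleton,
            Finset.mem_erase]; tauto
        · simp only [Finset.mem_symmDiff, Finset.mem_insert, Finset.mem_singleton,
            Finset.mem_erase]; tauto
      have h1 := Finset.card_le_card hs
      have h2 := Finset.card_insert_le b ((symmDiff X B).erase a)
      have h3 := Finset.card_erase_add_one haX
      omega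

theorem dmin_del {α : Type*} [DecidableEq α] (𝓕 : Finset (Finset α)) (hex : SymExch 𝓕)
    (a : α) (hn : ∃ F ∈ 𝓕, a ∉ F) (B : Finset α) (hB : a ∉ B) :
    dmin 𝓕 B = dmin (𝓕.filter (fun F => a ∉ F)) B := by
  obtain ⟨Z, hZ, hZa⟩ := hn
  apply le_antisymm
  · refine dmin_le_aux _ _ _ _ ⟨Z, by simp [hZ, hZa]⟩ fun X hX => ?_
    exact ⟨X, (Finset.mem_filter.1 hX).1, le_rfl⟩
  · refine dmin_le_aux _ _ _ _ ⟨Z, hZ⟩ fun X hX => ?_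
    obtain ⟨Y, hY, h1, h2⟩ := exch_aux 𝓕 hex a B X Z hX hZ (by tauto)
    exact ⟨Y, Finset.mem_filter.2 ⟨hY, by tauto⟩, h2⟩

theorem symm_erase_aux {α : Type*} [DecidableEq α] (a : α) (B X : Finset α) (hB : a ∉ B)
    (hX : a ∈ X) : symmDiff (X.erase a) B = symmDiff X (insert a B) := by
  ext c
  by_cases hca : c = a
  · subst hca
    simp [Finset.mem_symmDiff, hB, hX]
  · simp [Finset.mem_symmDiff, hca]

theorem dmin_con {α : Type*} [DecidableEq α] (𝓕 : Finset (Finset α)) (hex : SymExch 𝓕)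
    (a : α) (hn : ∃ F ∈ 𝓕, a ∈ F) (B : Finset α) (hB : a ∉ B) :
    dmin 𝓕 (insert a B) =
      dmin ((𝓕.filter (fun F => a ∈ F)).image (fun F => F.erase a)) B := by
  obtain ⟨Z, hZ, hZa⟩ := hn
  apply le_antisymm
  · refine dmin_le_aux _ _ _ _
      ⟨Z.erase a, Finset.mem_image.2 ⟨Z, by simp [hZ, hZa], rfl⟩⟩ fun X hX => ?_
    obtain ⟨Y, hY, rfl⟩ := Finset.mem_image.1 hX
    obtain ⟨hY, hYa⟩ := Finset.mem_filter.1 hY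
    exact ⟨Y, hY, by rw [symm_erase_aux a B Y hB hYa]⟩
  · refine dmin_le_aux _ _ _ _ ⟨Z, hZ⟩ fun X hX => ?_
    obtain ⟨Y, hY, h1, h2⟩ := exch_aux 𝓕 hex a (insert a B) X Z hX hZ (by simp [hZa])
    have hYa : a ∈ Y := by simpa using h1
    refine ⟨Y.erase a, Finset.mem_image.2 ⟨Y, Finset.mem_filter.2 ⟨hY, hYa⟩, rfl⟩, ?_⟩
    rwa [symm_erase_aux a B Y hB hYa]

/-- Deletion-contraction for the transition polynomial at a nonsingular
point `a`:
`Q_{(w,x,0)}(D;y) = w·Q_{(w,x,0)}(D∖a;y) + x·Q_{(w,x,0)}(D/a;y)`. -/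
theorem transQ_deletion_contraction {α : Type*} [DecidableEq α]
    (E : Finset α) (𝓕 : Finset (Finset α))
    (hne : 𝓕.Nonempty) (hsub : ∀ F ∈ 𝓕, F ⊆ E) (hex : SymExch 𝓕)
    (a : α) (ha : a ∈ E)
    (hnotloop : ∃ F ∈ 𝓕, a ∈ F) (hnotcoloop : ∃ F ∈ 𝓕, a ∉ F) :
    ∀ w x y : ℝ,
      transQ E 𝓕 w x y =
        w * transQ (E.erase a) (𝓕.filter (fun F => a ∉ F)) w x y +
          x * transQ (E.erase a)
              ((𝓕.filter (fun F => a ∈ F)).image (fun F => F.erase a)) w x y := by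
  intro w x y
  have hc := Finset.card_erase_add_one ha
  unfold transQ
  conv_lhs => rw [← Finset.insert_erase ha]
  rw [Finset.sum_powerset_insert (Finset.notMem_erase a E), Finset.mul_sum, Finset.mul_sum,
    Finset.insert_erase ha]
  congr 1
  · refine Finset.sum_congr rfl fun B hB => ?_
    have hBE := Finset.mem_powerset.1 hB
    have haB : a ∉ B := fun h => Finset.notMem_erase a E (hBE h)
    have hle := Finset.card_le_card hBE
    rw [dmin_del 𝓕 hex a hnotcoloop B haB,
      show E.card - B.card = ((E.erase a).card - B.card) + 1 by omega, pow_succ]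
    ring
  · refine Finset.sum_congr rfl fun B hB => ?_
    have hBE := Finset.mem_powerset.1 hB
    have haB : a ∉ B := fun h => Finset.notMem_erase a E (hBE h)
    rw [dmin_con 𝓕 hex a hnotloop B haB, Finset.card_insert_of_notMem haB,
      show E.card - (B.card + 1) = (E.erase a).card - B.card by omega, pow_succ]
    ring
end
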